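/- arXiv:1203.0828 — 3 statements merged into one kernel-verified Lean document; each statement's English description precedes it below -/
import Mathlib

section
/- A continuous nonnegative function h : ℝ → [0,∞) is log-concave if and only if it is a Pólya frequency function of order 2, i.e. if and only if for all x₁ ≤ x₂ and y₁ ≤ y₂ one has h(x₁−y₁)·h(x₂−y₂) − h(x₁−y₂)·h(x₂−y₁) ≥ 0. -/
/-- The order-two Pólya frequency inequality, in terms of two points of a segment placed
symmetrically about its midpoint. -/
theorem mul_le_mul_of_polyaFrequency {h : ℝ → ℝ}
    (hpf : ∀ x₁ x₂ y₁ y₂ : ℝ, x₁ ≤ x₂ → y₁ ≤ y₂ →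
      0 ≤ h (x₁ - y₁) * h (x₂ - y₂) - h (x₁ - y₂) * h (x₂ - y₁))
    (x y : ℝ) {θ : ℝ} (h0 : 0 ≤ θ) (h1 : θ ≤ 1) :
    h x * h y ≤ h (θ * x + (1 - θ) * y) * h ((1 - θ) * x + θ * y) := by
  rcases le_total x y with hxy | hxy
  · have := hpf (θ * x + (1 - θ) * y) y 0 (θ * x + (1 - θ) * y - x)
      (by nlinarith) (by nlinarith)
    rw [sub_zero, sub_zero, sub_sub_cancel,
      show y - (θ * x + (1 - θ) * y - x) = (1 - θ) * x + θ * y by ring] at this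
    linarith
  · have := hpf (θ * x + (1 - θ) * y) x 0 (θ * x + (1 - θ) * y - y)
      (by nlinarith) (by nlinarith)
    rw [sub_zero, sub_zero, sub_sub_cancel,
      show x - (θ * x + (1 - θ) * y - y) = (1 - θ) * x + θ * y by ring] at this
    linarith

/-- A continuous midpoint-concave function on `[0, 1]` vanishing at the endpoints is
nonnegative. -/
theorem nonneg_of_midpoint_concave {g : ℝ → ℝ} (hg : ContinuousOn g (Set.Icc 0 1))
    (g0 : g 0 = 0) (g1 : g 1 = 0)
    (hmid : ∀ s ∈ Set.Icc (0 : ℝ) 1, ∀ t ∈ Set.Icc (0 : ℝ) 1,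
      g s + g t ≤ 2 * g ((s + t) / 2))
    {t : ℝ} (ht : t ∈ Set.Icc (0 : ℝ) 1) : 0 ≤ g t := by
  obtain ⟨c, hc, hmin⟩ := isCompact_Icc.exists_isMinOn ⟨t, ht⟩ hg
  refine le_trans ?_ (hmin ht)
  rcases le_total c (1 / 2) with hc' | hc'
  · have hm : 2 * c ∈ Set.Icc (0 : ℝ) 1 := ⟨by linarith [hc.1], by linarith⟩
    have h1 := hmid 0 (by simp) (2 * c) hm
    rw [show (0 + 2 * c) / 2 = c by ring] at h1
    have h2 : g c ≤ g (2 * c) := hmin hm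
    linarith
  · have hm : 2 * c - 1 ∈ Set.Icc (0 : ℝ) 1 := ⟨by linarith, by linarith [hc.2]⟩
    have h1 := hmid 1 (by simp) (2 * c - 1) hm
    rw [show (1 + (2 * c - 1)) / 2 = c by ring] at h1
    have h2 : g c ≤ g (2 * c - 1) := hmin hm
    linarith

/-- The log-concavity inequality between two points where `h` is positive. -/
theorem rpow_mul_rpow_le_of_polyaFrequency {h : ℝ → ℝ} (h_nonneg : ∀ x, 0 ≤ h x)
    (h_cont : Continuous h)
    (hpf : ∀ x₁ x₂ y₁ y₂ : ℝ, x₁ ≤ x₂ → y₁ ≤ y₂ →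
      0 ≤ h (x₁ - y₁) * h (x₂ - y₂) - h (x₁ - y₂) * h (x₂ - y₁))
    {x y θ : ℝ} (hx : 0 < h x) (hy : 0 < h y) (hθ : θ ∈ Set.Icc (0 : ℝ) 1) :
    h x ^ θ * h y ^ (1 - θ) ≤ h (θ * x + (1 - θ) * y) := by
  have hpos : ∀ t ∈ Set.Icc (0 : ℝ) 1, 0 < h (t * x + (1 - t) * y) := fun t ht =>
    pos_of_mul_pos_left
      ((mul_pos hx hy).trans_le (mul_le_mul_of_polyaFrequency hpf x y ht.1 ht.2))
      (h_nonneg _)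
  have key := nonneg_of_midpoint_concave
    (g := fun t => Real.log (h (t * x + (1 - t) * y))
      - (t * Real.log (h x) + (1 - t) * Real.log (h y)))
    (by
      refine ContinuousOn.sub (ContinuousOn.log ?_ fun t ht => (hpos t ht).ne') ?_
      · exact (h_cont.comp (by fun_prop)).continuousOn
      · fun_prop)
    (by simp) (by simp)
    (by
      intro s hs t ht
      have hst : (s + t) / 2 ∈ Set.Icc (0 : ℝ) 1 :=
        ⟨by linarith [hs.1, ht.1], by linarith [hs.2, ht.2]⟩
      have hm := mul_le_mul_of_polyaFrequency hpf (s * x + (1 - s) * y) (t * x + (1 - t) * y)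
        (θ := 1 / 2) (by norm_num) (by norm_num)
      rw [show (1 / 2 : ℝ) * (s * x + (1 - s) * y) + (1 - 1 / 2) * (t * x + (1 - t) * y)
          = (s + t) / 2 * x + (1 - (s + t) / 2) * y by ring,
        show (1 - 1 / 2 : ℝ) * (s * x + (1 - s) * y) + 1 / 2 * (t * x + (1 - t) * y)
          = (s + t) / 2 * x + (1 - (s + t) / 2) * y by ring] at hm
      have hl := Real.log_le_log (mul_pos (hpos s hs) (hpos t ht)) hm
      rw [Real.log_mul (hpos s hs).ne' (hpos t ht).ne',
        Real.log_mul (hpos _ hst).ne' (hpos _ hst).ne'] at hl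
      linarith)
    hθ
  rw [Real.rpow_def_of_pos hx, Real.rpow_def_of_pos hy, ← Real.exp_add,
    ← Real.le_log_iff_exp_le (hpos θ hθ)]
  linarith

/-- A continuous nonnegative function `h : ℝ → [0,∞)` is log-concave if and only if
it is a Pólya frequency function of order 2. -/
theorem logConcave_iff_polyaFrequency_order_two
    (h : ℝ → ℝ) (h_nonneg : ∀ x, 0 ≤ h x) (h_cont : Continuous h) :
    (∀ x y θ : ℝ, 0 ≤ θ → θ ≤ 1 →
        h x ^ θ * h y ^ (1 - θ) ≤ h (θ * x + (1 - θ) * y)) ↔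
      (∀ x₁ x₂ y₁ y₂ : ℝ, x₁ ≤ x₂ → y₁ ≤ y₂ →
        0 ≤ h (x₁ - y₁) * h (x₂ - y₂) - h (x₁ - y₂) * h (x₂ - y₁)) := by
  constructor
  · intro hlc x₁ x₂ y₁ y₂ hx hy
    rcases (add_nonneg (sub_nonneg.2 hx) (sub_nonneg.2 hy)).eq_or_lt with hd | hd
    · obtain rfl : x₁ = x₂ := by linarith
      obtain rfl : y₁ = y₂ := by linarith
      simp
    set d := x₂ - x₁ + (y₂ - y₁) with hd_def
    set θ := (x₂ - x₁) / d with hθ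
    have hθ0 : 0 ≤ θ := div_nonneg (sub_nonneg.2 hx) hd.le
    have hθ1 : θ ≤ 1 := (div_le_one hd).2 (by linarith)
    have hθd : θ * d = x₂ - x₁ := div_mul_cancel₀ _ hd.ne'
    have e₁ := hlc (x₁ - y₂) (x₂ - y₁) θ hθ0 hθ1
    have e₂ := hlc (x₂ - y₁) (x₁ - y₂) θ hθ0 hθ1
    rw [show θ * (x₁ - y₂) + (1 - θ) * (x₂ - y₁) = x₁ - y₁ by linear_combination -hθd] at e₁
    rw [show θ * (x₂ - y₁) + (1 - θ) * (x₁ - y₂) = x₂ - y₂ by linear_combination hθd] at e₂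
    have rpow_mul_rpow_compl : ∀ a : ℝ, 0 ≤ a → a ^ θ * a ^ (1 - θ) = a := fun a ha => by
      rw [← Real.rpow_add_of_nonneg ha hθ0 (sub_nonneg.2 hθ1), add_sub_cancel, Real.rpow_one]
    have hprod := mul_le_mul e₁ e₂
      (mul_nonneg (Real.rpow_nonneg (h_nonneg _) _) (Real.rpow_nonneg (h_nonneg _) _))
      (h_nonneg _)
    rw [mul_mul_mul_comm, mul_comm (h (x₂ - y₁) ^ (1 - θ)), mul_mul_mul_comm,
      rpow_mul_rpow_compl _ (h_nonneg _), rpow_mul_rpow_compl _ (h_nonneg _)] at hprod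
    linarith
  · intro hpf x y θ h0 h1
    rcases h0.eq_or_lt with rfl | h0'
    · simp
    rcases h1.eq_or_lt with rfl | h1'
    · simp
    rcases (h_nonneg x).eq_or_lt with hx | hx
    · rw [← hx, Real.zero_rpow h0'.ne', zero_mul]
      exact h_nonneg _
    rcases (h_nonneg y).eq_or_lt with hy | hy
    · rw [← hy, Real.zero_rpow (sub_pos.2 h1').ne', mul_zero]
      exact h_nonneg _
    exact rpow_mul_rpow_le_of_polyaFrequency h_nonneg h_cont hpf hx hy ⟨h0, h1⟩
end

section
/- Define g : ℝ → ℝ by g(z) = (2/π)^{1/4}·exp(π²/12 + z − ∫₀^{e^z} (log(1+t)/t) dt). Then for every z ∈ ℝ, (1/2)·g(z)·g(−z) = (2π)^{−1/2}·exp(−z²/2); that is, the standard normal density φ admits the symmetric product representation φ(z) = (1/2)·g(z)·g(−z). -/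
open MeasureTheory in
theorem intervalIntegrable_log_one_add_div {x : ℝ} (hx : 0 ≤ x) :
    IntervalIntegrable (fun t : ℝ => Real.log (1 + t) / t) volume 0 x := by
  rw [intervalIntegrable_iff_integrableOn_Ioc_of_le hx]
  refine Measure.integrableOn_of_bounded (M := 1) (by simp) ?_ ?_
  · exact (by fun_prop : Measurable fun t : ℝ => Real.log (1 + t) / t).aestronglyMeasurable
  · filter_upwards [ae_restrict_mem measurableSet_Ioc] with t ht
    have ht0 : 0 < t := ht.1
    have hlog : 0 ≤ Real.log (1 + t) := Real.log_nonneg (by linarith)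
    rw [Real.norm_of_nonneg (by positivity), div_le_one ht0]
    linarith [Real.log_le_sub_one_of_pos (by linarith : 0 < 1 + t)]

theorem hasDerivAt_integral_log_one_add_div {x : ℝ} (hx : 0 < x) :
    HasDerivAt (fun y : ℝ => ∫ t in (0 : ℝ)..y, Real.log (1 + t) / t)
      (Real.log (1 + x) / x) x := by
  refine intervalIntegral.integral_hasDerivAt_right
    (intervalIntegrable_log_one_add_div hx.le) ?_ ?_
  · exact (by fun_prop : Measurable fun t : ℝ => Real.log (1 + t) / t).stronglyMeasurable
      |>.stronglyMeasurableAtFilter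
  · exact ContinuousAt.div ((continuousAt_const.add continuousAt_id).log (by simp; linarith))
      continuousAt_id hx.ne'

theorem hasSum_neg_one_pow_div_succ_sq :
    HasSum (fun n : ℕ => (-1 : ℝ) ^ n / ((n : ℝ) + 1) ^ 2) (Real.pi ^ 2 / 12) := by
  have hz := hasSum_zeta_two
  have heven : HasSum (fun n : ℕ => (1 : ℝ) / ((2 * n : ℕ) : ℝ) ^ 2) (Real.pi ^ 2 / 24) := by
    rw [show Real.pi ^ 2 / 24 = 1 / 4 * (Real.pi ^ 2 / 6) by ring]
    refine (hz.mul_left (1 / 4 : ℝ)).congr_fun fun n => ?_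
    push_cast
    rw [mul_pow, div_mul_div_comm]
    norm_num
  have hodd_summable : Summable (fun n : ℕ => (1 : ℝ) / ((2 * n + 1 : ℕ) : ℝ) ^ 2) :=
    hz.summable.comp_injective (i := fun n : ℕ => 2 * n + 1) fun a b h => by simpa using h
  have hodd := hodd_summable.hasSum
  have htotal := (HasSum.even_add_odd (f := fun n : ℕ => (1 : ℝ) / (n : ℝ) ^ 2)
    heven hodd).unique hz
  have halt : HasSum (fun n : ℕ => -(-1 : ℝ) ^ n / (n : ℝ) ^ 2) (Real.pi ^ 2 / 12) := by
    rw [show Real.pi ^ 2 / 12 = -(Real.pi ^ 2 / 24) +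
      ∑' n : ℕ, (1 : ℝ) / ((2 * n + 1 : ℕ) : ℝ) ^ 2 by linarith]
    refine HasSum.even_add_odd (heven.neg.congr_fun fun n => ?_)
      (hodd.congr_fun fun n => ?_)
    · simp [pow_mul, neg_div]
    · simp [pow_succ, pow_mul]
  rw [← hasSum_nat_add_iff' 1] at halt
  simpa [pow_succ] using halt

open MeasureTheory in
theorem integral_zero_one_log_one_add_div :
    ∫ t in (0 : ℝ)..1, Real.log (1 + t) / t = Real.pi ^ 2 / 12 := by
  have hint (n : ℕ) : ∫ t in Set.Ioc (0 : ℝ) 1, t ^ n / (n + 1) = 1 / ((n : ℝ) + 1) ^ 2 := by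
    rw [← intervalIntegral.integral_of_le zero_le_one, intervalIntegral.integral_div,
      integral_pow]
    simp
    field_simp
  have hsum := hasSum_integral_of_summable_integral_norm
    (μ := volume.restrict (Set.Ioc (0 : ℝ) 1))
    (F := fun (n : ℕ) (t : ℝ) => (-1 : ℝ) ^ n * (t ^ n / (n + 1)))
    (fun n => (by fun_prop :
      Continuous fun t : ℝ => (-1 : ℝ) ^ n * (t ^ n / (n + 1))).integrableOn_Ioc) ?_
  · have hterm (n : ℕ) : ∫ t in Set.Ioc (0 : ℝ) 1, (-1 : ℝ) ^ n * (t ^ n / (n + 1)) =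
        (-1 : ℝ) ^ n / ((n : ℝ) + 1) ^ 2 := by
      rw [integral_const_mul, hint, mul_one_div]
    simp only [hterm] at hsum
    rw [hasSum_neg_one_pow_div_succ_sq.unique hsum,
      intervalIntegral.integral_of_le zero_le_one, integral_Ioc_eq_integral_Ioo,
      integral_Ioc_eq_integral_Ioo]
    refine setIntegral_congr_fun measurableSet_Ioo fun t ht => ?_
    have hlog := (Real.hasSum_pow_div_log_of_abs_lt_one (x := -t)
      (by rw [abs_neg, abs_of_pos ht.1]; exact ht.2)).neg.div_const t
    rw [neg_neg, sub_neg_eq_add] at hlog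
    refine hlog.tsum_eq.symm.trans (tsum_congr fun n => ?_)
    have ht0 : t ≠ 0 := ht.1.ne'
    rw [neg_pow, pow_succ, pow_succ]
    field_simp
  · have hnorm (n : ℕ) : ∫ t in Set.Ioc (0 : ℝ) 1, ‖(-1 : ℝ) ^ n * (t ^ n / (n + 1))‖ =
        1 / ((n : ℝ) + 1) ^ 2 := by
      rw [← hint n]
      refine setIntegral_congr_fun measurableSet_Ioc fun t ht => ?_
      have ht0 : 0 < t := ht.1
      simp only [norm_mul, norm_pow, norm_neg, norm_one, one_pow, one_mul]
      exact Real.norm_of_nonneg (by positivity)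
    simp only [hnorm]
    exact_mod_cast (summable_nat_add_iff 1).2 hasSum_zeta_two.summable

theorem integral_log_one_add_div_exp_add_exp_neg (z : ℝ) :
    (∫ t in (0 : ℝ)..Real.exp z, Real.log (1 + t) / t) +
      (∫ t in (0 : ℝ)..Real.exp (-z), Real.log (1 + t) / t) =
      Real.pi ^ 2 / 6 + z ^ 2 / 2 := by
  set F : ℝ → ℝ := fun y => ∫ t in (0 : ℝ)..y, Real.log (1 + t) / t
  have hderiv (w : ℝ) :
      HasDerivAt (fun w => F (Real.exp w) + F (Real.exp (-w)) - w ^ 2 / 2) 0 w := by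
    have hpos := (hasDerivAt_integral_log_one_add_div (Real.exp_pos w)).comp w
      (Real.hasDerivAt_exp w)
    have hneg := (hasDerivAt_integral_log_one_add_div (Real.exp_pos (-w))).comp w
      (hasDerivAt_neg w).exp
    have hlog : Real.log (1 + Real.exp w) = w + Real.log (1 + Real.exp (-w)) := by
      rw [← Real.log_exp w, ← Real.log_mul (by positivity) (by positivity), Real.log_exp,
        mul_add, ← Real.exp_add]
      simp [add_comm]
    refine ((hpos.add hneg).sub ((hasDerivAt_pow 2 w).div_const 2)).congr_deriv ?_
    rw [hlog]
    field_simp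
    simp [mul_comm]
  have hconst := is_const_of_deriv_eq_zero (fun w => (hderiv w).differentiableAt)
    (fun w => (hderiv w).deriv) z 0
  have hone : F 1 = Real.pi ^ 2 / 12 := integral_zero_one_log_one_add_div
  simp only [neg_zero, Real.exp_zero, hone] at hconst
  change F (Real.exp z) + F (Real.exp (-z)) = _
  linarith

/-- With `g z = (2/π)^{1/4} exp(π²/12 + z - ∫₀^{e^z} log(1+t)/t dt)`, the standard
normal density admits the symmetric product representation
`(1/2) g z g (-z) = (2π)^{-1/2} exp(-z²/2)`. -/
theorem gaussian_symmetric_product_representation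
    (g : ℝ → ℝ)
    (hg : ∀ z, g z = (2 / Real.pi) ^ ((1 : ℝ) / 4) *
      Real.exp (Real.pi ^ 2 / 12 + z -
        ∫ t in (0 : ℝ)..(Real.exp z), Real.log (1 + t) / t)) :
    ∀ z : ℝ, (1 / 2) * g z * g (-z) =
      (2 * Real.pi) ^ (-(1 : ℝ) / 2) * Real.exp (-z ^ 2 / 2) := by
  intro z
  have hpi := Real.pi_pos
  have hreflection := integral_log_one_add_div_exp_add_exp_neg z
  have hcoeff : (1 / 2 : ℝ) * ((2 / Real.pi) ^ ((1 : ℝ) / 4) * (2 / Real.pi) ^ ((1 : ℝ) / 4)) =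
      (2 * Real.pi) ^ (-(1 : ℝ) / 2) := by
    have hfour : 2 / Real.pi = 4 * (2 * Real.pi)⁻¹ := by field_simp; norm_num
    have hsqrt : (4 : ℝ) ^ ((1 : ℝ) / 2) = 2 := by
      rw [← Real.sqrt_eq_rpow, show (4 : ℝ) = 2 ^ 2 by norm_num]
      exact Real.sqrt_sq (by norm_num)
    rw [← Real.rpow_add (by positivity), show (1 : ℝ) / 4 + 1 / 4 = 1 / 2 by norm_num, hfour,
      Real.mul_rpow (by norm_num) (by positivity), hsqrt, Real.inv_rpow (by positivity),
      neg_div, Real.rpow_neg (by positivity)]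
    ring
  rw [hg, hg, ← hcoeff, show -z ^ 2 / 2 =
    (Real.pi ^ 2 / 12 + z - ∫ t in (0 : ℝ)..Real.exp z, Real.log (1 + t) / t) +
    (Real.pi ^ 2 / 12 + -z - ∫ t in (0 : ℝ)..Real.exp (-z), Real.log (1 + t) / t) by linarith,
    Real.exp_add]
  ring
end

section
/- The function g : ℝ → ℝ defined by g(z) = (2/π)^{1/4}·exp(π²/12 + z − ∫₀^{e^z} (log(1+t)/t) dt) is integrable on ℝ with respect to Lebesgue measure. -/
theorem log_one_add_div_nonneg {t : ℝ} (ht : 0 ≤ t) : 0 ≤ Real.log (1 + t) / t :=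
  div_nonneg (Real.log_nonneg (by linarith)) ht

theorem log_one_add_div_le_one {t : ℝ} (ht : 0 ≤ t) : Real.log (1 + t) / t ≤ 1 := by
  refine div_le_one_of_le₀ ?_ ht
  have := Real.log_le_sub_one_of_pos (show 0 < 1 + t by linarith)
  linarith

theorem measurable_log_one_add_div : Measurable fun t : ℝ => Real.log (1 + t) / t := by
  fun_prop

theorem intervalIntegrable_log_one_add_div_s13 {a b : ℝ} (ha : 0 ≤ a) (hb : 0 ≤ b) :
    IntervalIntegrable (fun t : ℝ => Real.log (1 + t) / t) MeasureTheory.volume a b := by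
  refine (intervalIntegrable_const (c := (1 : ℝ))).mono_fun
    measurable_log_one_add_div.aestronglyMeasurable ?_
  filter_upwards [MeasureTheory.ae_restrict_mem measurableSet_uIoc] with t ht
  have h0 : 0 ≤ t := (le_min ha hb).trans ht.1.le
  rw [Real.norm_of_nonneg (log_one_add_div_nonneg h0), norm_one]
  exact log_one_add_div_le_one h0

theorem integral_log_one_add_div_nonneg {a b : ℝ} (ha : 0 ≤ a) (hab : a ≤ b) :
    0 ≤ ∫ t in a..b, Real.log (1 + t) / t :=
  intervalIntegral.integral_nonneg hab fun _ ht => log_one_add_div_nonneg (ha.trans ht.1)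

theorem monotone_integral_log_one_add_div_exp :
    Monotone fun z : ℝ => ∫ t in (0 : ℝ)..Real.exp z, Real.log (1 + t) / t := by
  intro y z hyz
  have h := intervalIntegral.integral_add_adjacent_intervals
    (intervalIntegrable_log_one_add_div_s13 le_rfl (Real.exp_pos y).le)
    (intervalIntegrable_log_one_add_div_s13 (Real.exp_pos y).le (Real.exp_pos z).le)
  have h' := integral_log_one_add_div_nonneg (Real.exp_pos y).le (Real.exp_le_exp.2 hyz)
  dsimp only
  linarith

theorem two_mul_sub_four_le_integral_log_one_add_div (z : ℝ) :
    2 * z - 4 ≤ ∫ t in (0 : ℝ)..Real.exp z, Real.log (1 + t) / t := by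
  rcases le_total z 2 with hz | hz
  · have := integral_log_one_add_div_nonneg le_rfl (Real.exp_pos z).le
    linarith
  have h2 := Real.exp_pos 2
  have hle := Real.exp_le_exp.2 hz
  have hsplit := intervalIntegral.integral_add_adjacent_intervals
    (intervalIntegrable_log_one_add_div_s13 le_rfl h2.le)
    (intervalIntegrable_log_one_add_div_s13 h2.le (Real.exp_pos z).le)
  have hnonneg := integral_log_one_add_div_nonneg le_rfl h2.le
  have hint : ∫ t in Real.exp 2..Real.exp z, 2 * (1 / t) = 2 * (z - 2) := by
    rw [intervalIntegral.integral_const_mul, integral_one_div_of_pos h2 (Real.exp_pos z),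
      ← Real.exp_sub, Real.log_exp]
  have hmono : ∫ t in Real.exp 2..Real.exp z, 2 * (1 / t) ≤
      ∫ t in Real.exp 2..Real.exp z, Real.log (1 + t) / t := by
    refine intervalIntegral.integral_mono_on hle ?_
      (intervalIntegrable_log_one_add_div_s13 h2.le (Real.exp_pos z).le) fun t ht => ?_
    · refine (intervalIntegral.intervalIntegrable_one_div (fun t ht => ?_)
        continuousOn_id).const_mul 2
      rw [Set.uIcc_of_le hle] at ht
      exact (h2.trans_le ht.1).ne'
    · have ht0 : 0 < t := h2.trans_le ht.1
      rw [mul_one_div]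
      gcongr
      rw [Real.le_log_iff_exp_le (by linarith)]
      linarith [ht.1]
  linarith

/-- The function `g z = (2/π)^{1/4} exp(π²/12 + z - ∫₀^{e^z} log(1+t)/t dt)` is
integrable on `ℝ` with respect to Lebesgue measure. -/
theorem g_integrable
    (g : ℝ → ℝ)
    (hg : ∀ z, g z = (2 / Real.pi) ^ ((1 : ℝ) / 4) *
      Real.exp (Real.pi ^ 2 / 12 + z -
        ∫ t in (0 : ℝ)..(Real.exp z), Real.log (1 + t) / t)) :
    MeasureTheory.Integrable g MeasureTheory.volume := by
  rw [funext hg]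
  refine MeasureTheory.Integrable.const_mul ?_ _
  have hmeas : Measurable fun z : ℝ => Real.exp (Real.pi ^ 2 / 12 + z -
      ∫ t in (0 : ℝ)..(Real.exp z), Real.log (1 + t) / t) :=
    Real.measurable_exp.comp
      ((measurable_id.const_add _).sub monotone_integral_log_one_add_div_exp.measurable)
  rw [← MeasureTheory.integrableOn_univ, ← Set.Iic_union_Ioi (a := (0 : ℝ))]
  refine MeasureTheory.IntegrableOn.union ?_ ?_
  · refine ((integrableOn_exp_Iic 0).const_mul (Real.exp (Real.pi ^ 2 / 12))).mono'
      hmeas.aestronglyMeasurable (Filter.Eventually.of_forall fun z => ?_)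
    rw [Real.norm_of_nonneg (Real.exp_pos _).le, ← Real.exp_add, Real.exp_le_exp]
    linarith [integral_log_one_add_div_nonneg le_rfl (Real.exp_pos z).le]
  · refine ((integrableOn_exp_neg_Ioi 0).const_mul (Real.exp (Real.pi ^ 2 / 12 + 4))).mono'
      hmeas.aestronglyMeasurable (Filter.Eventually.of_forall fun z => ?_)
    rw [Real.norm_of_nonneg (Real.exp_pos _).le, ← Real.exp_add, Real.exp_le_exp]
    linarith [two_mul_sub_four_le_integral_log_one_add_div z]
end
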